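/- (Algebraic core of Theorem 1: vanishing of the central extension.) Let g be a real orthogonal 4×4 matrix (gᵀg = 1), let k, y ∈ ℝ³ with self-dual matrices K, Y, and for a, b ∈ {1,2,3} set Δ_{ab} := g⁻¹ [T_{+a}, K] [Y, K] [T_{+b}, K] g. Then the symmetric part of Δ_{ab} vanishes, i.e. Δ_{ab} + Δ_{ab}ᵀ = 0. -/

import Mathlib

noncomputable section
open Matrix BigOperators

/-- The so(4) generator `T_{ab}` with entries `(T_{ab})^I_J = δ_a^I δ_{bJ} − δ_{aJ} δ_b^I`. -/
def Tgen (a b : Fin 4) : Matrix (Fin 4) (Fin 4) ℝ :=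
  Matrix.of fun I J =>
    (if I = a then (1:ℝ) else 0) * (if J = b then (1:ℝ) else 0)
      - (if J = a then (1:ℝ) else 0) * (if I = b then (1:ℝ) else 0)

/-- The three-dimensional Levi-Civita symbol. -/
def eps3 (a b c : Fin 3) : ℝ :=
  ((((b:ℤ) - (a:ℤ)) * ((c:ℤ) - (a:ℤ)) * ((c:ℤ) - (b:ℤ)) : ℤ) : ℝ) / 2

/-- The self-dual generators `T_{+a} = ½(T_{0a} + ½ Σ ε_{abc} T_{bc})`, `a = 1,2,3`. -/
def Tplus (a : Fin 3) : Matrix (Fin 4) (Fin 4) ℝ :=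
  (1/2 : ℝ) • (Tgen 0 a.succ
    + (1/2 : ℝ) • ∑ b : Fin 3, ∑ c : Fin 3, eps3 a b c • Tgen b.succ c.succ)

/-- The self-dual matrix `Σ_a u^a T_{+a}` of a vector `u ∈ ℝ³`. -/
def sd (u : Fin 3 → ℝ) : Matrix (Fin 4) (Fin 4) ℝ := ∑ a : Fin 3, u a • Tplus a


lemma sd_eq (u : Fin 3 → ℝ) :
    sd u = (1 / 2 : ℝ) • !![0, u 0, u 1, u 2; -u 0, 0, u 2, -u 1;
      -u 1, -u 2, 0, u 0; -u 2, u 1, -u 0, 0] := by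
  simp only [sd, Tplus, eps3, Fin.sum_univ_three]
  norm_num [Fin.succ_one_eq_two]
  ext i j
  fin_cases i <;> fin_cases j <;> simp [Tgen, Fin.succ] <;> ring

lemma Tplus_eq_sd (a : Fin 3) : Tplus a = sd (Pi.single a 1) := by
  simp [sd, Pi.single_apply]

/-- The commutator of self-dual matrices is the cross product of their vectors, up to sign. -/
lemma sd_commutator (u v : Fin 3 → ℝ) :
    sd u * sd v - sd v * sd u = -sd (crossProduct u v) := by
  simp only [sd_eq]
  ext i j
  fin_cases i <;> fin_cases j <;>
    simp [cross_apply] <;> ring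

/-- The symmetric part of a product of three self-dual matrices is a multiple of the identity,
given by the triple product of their vectors. -/
lemma sd_mul_sd_mul_sd_add_transpose (u v w : Fin 3 → ℝ) :
    sd u * sd v * sd w + (sd u * sd v * sd w)ᵀ
      = ((1 / 4 : ℝ) * (u ⬝ᵥ crossProduct v w)) • (1 : Matrix (Fin 4) (Fin 4) ℝ) := by
  simp only [sd_eq]
  ext i j
  fin_cases i <;> fin_cases j <;>
    simp [cross_apply, dotProduct, Fin.sum_univ_three] <;> ring

/-- Three vectors orthogonal to a common vector `k` have vanishing triple product. -/
lemma triple_product_cross_right (u v w k : Fin 3 → ℝ) :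
    crossProduct u k ⬝ᵥ crossProduct (crossProduct v k) (crossProduct w k) = 0 := by
  simp [cross_apply, dotProduct, Fin.sum_univ_three]
  ring

/-- algebraic core of Theorem 1: the symmetric part of the central
extension `Δ_{ab} = g⁻¹[T_{+a},K][Y,K][T_{+b},K]g` vanishes for orthogonal `g`. -/
theorem central_extension_symmetric_part_vanishes (g : Matrix (Fin 4) (Fin 4) ℝ)
    (hg : gᵀ * g = 1) (k y : Fin 3 → ℝ) (a b : Fin 3)
    (Δ : Matrix (Fin 4) (Fin 4) ℝ)
    (hΔ : Δ = g⁻¹ * (Tplus a * sd k - sd k * Tplus a)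
        * (sd y * sd k - sd k * sd y) * (Tplus b * sd k - sd k * Tplus b) * g) :
    Δ + Δᵀ = 0 := by
  have hinv : g⁻¹ = gᵀ := Matrix.inv_eq_left_inv hg
  subst hΔ
  simp only [hinv, Tplus_eq_sd, sd_commutator]
  have h := sd_mul_sd_mul_sd_add_transpose (crossProduct (Pi.single a 1) k)
    (crossProduct y k) (crossProduct (Pi.single b 1) k)
  rw [triple_product_cross_right, mul_zero, zero_smul] at h
  set A := sd (crossProduct (Pi.single a 1) k)
  set B := sd (crossProduct y k)
  set C := sd (crossProduct (Pi.single b 1) k)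
  calc gᵀ * -A * -B * -C * g + (gᵀ * -A * -B * -C * g)ᵀ
      = -(gᵀ * (A * B * C + (A * B * C)ᵀ) * g) := by
        simp only [transpose_mul, transpose_neg, transpose_transpose]
        noncomm_ring
    _ = 0 := by rw [h]; simp

end
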